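/- arXiv:1410.7524 — 2 statements merged into one kernel-verified Lean document; each statement's English description precedes it below -/
import Mathlib

section
/- Let n ≡ 0 (mod 6) and let g ∈ S_n be a permutation whose cycle type is the multiset {n/3, n/3, n/3} (a product of three disjoint n/3-cycles with no fixed points). Then there exists a subset s of Fin n with |s| = n/2 and g(s) = sᶜ; in particular, g lies in the stabilizer of a partition of Fin n into two blocks of size n/2. -/
open Pointwise

/-- If `x` is moved by `g` and all cycles of `g` have even length, then only even powers of `g`
fix `x`. -/
theorem Equiv.Perm.even_of_zpow_apply_eq_self {α : Type*} [Fintype α] [DecidableEq α]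
    {g : Equiv.Perm α} (heven : ∀ m ∈ g.cycleType, Even m) {x : α} (hx : g x ≠ x) {k : ℤ}
    (hk : (g ^ k) x = x) : Even k := by
  have hcycle : (g.cycleOf x).IsCycle := Equiv.Perm.isCycle_cycleOf g hx
  have hmem : g.cycleOf x ∈ g.cycleFactorsFinset :=
    Equiv.Perm.cycleOf_mem_cycleFactorsFinset_iff.2 (Equiv.Perm.mem_support.2 hx)
  have hord : Even (orderOf (g.cycleOf x)) := by
    apply heven
    rw [hcycle.orderOf, Equiv.Perm.cycleType_def]
    exact Multiset.mem_map_of_mem _ hmem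
  have hone : g.cycleOf x ^ k = 1 := by
    have hnonneg : 0 ≤ k % (orderOf (g.cycleOf x) : ℤ) :=
      Int.emod_nonneg _ (by exact_mod_cast (orderOf_pos (g.cycleOf x)).ne')
    rw [← zpow_mod_orderOf, ← Int.toNat_of_nonneg hnonneg, zpow_natCast]
    refine hcycle.pow_eq_one_iff.2 ⟨x, ?_, ?_⟩
    · rwa [Equiv.Perm.cycleOf_apply_self]
    · rw [← zpow_natCast, Int.toNat_of_nonneg hnonneg, zpow_mod_orderOf,
        Equiv.Perm.cycleOf_zpow_apply_self, hk]
  exact even_iff_two_dvd.2 (dvd_trans (by exact_mod_cast hord.two_dvd)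
    (orderOf_dvd_iff_zpow_eq_one.2 hone))

/-- A fixed-point-free permutation all of whose cycles have even length maps some set to its
complement. -/
theorem Equiv.Perm.exists_smul_eq_compl {α : Type*} [Fintype α] [DecidableEq α]
    {g : Equiv.Perm α} (heven : ∀ m ∈ g.cycleType, Even m) (hfix : ∀ x, g x ≠ x) :
    ∃ s : Finset α, g • s = sᶜ := by
  classical
  let r : α → α := fun x => (Quotient.mk (Equiv.Perm.SameCycle.setoid g) x).out
  have hr (x : α) : g.SameCycle (r x) x := Quotient.mk_out (s := Equiv.Perm.SameCycle.setoid g) x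
  have hrg (x : α) : r (g x) = r x := congrArg Quotient.out
    (Quotient.sound (s := Equiv.Perm.SameCycle.setoid g)
      (Equiv.Perm.sameCycle_apply_left.2 (Equiv.Perm.SameCycle.refl g x)))
  let s : Finset α := Finset.univ.filter fun x => ∃ k : ℤ, Even k ∧ (g ^ k) (r x) = x
  have hs {x : α} {k : ℤ} (hk : (g ^ k) (r x) = x) : x ∈ s ↔ Even k := by
    refine ⟨fun hx => ?_, fun h => Finset.mem_filter.2 ⟨Finset.mem_univ x, k, h, hk⟩⟩
    obtain ⟨-, j, hj, hjx⟩ := Finset.mem_filter.1 hx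
    have h : (g ^ (-j + k)) (r x) = r x := by
      rw [zpow_add, Equiv.Perm.mul_apply, hk, zpow_neg, Equiv.Perm.inv_eq_iff_eq, hjx]
    have := Equiv.Perm.even_of_zpow_apply_eq_self heven (hfix _) h
    simpa [Int.even_add, hj] using this
  refine ⟨s, ?_⟩
  ext y
  obtain ⟨x, rfl⟩ := g.surjective y
  obtain ⟨k, hk⟩ := hr x
  have hgk : (g ^ (1 + k)) (r (g x)) = g x := by
    rw [hrg, zpow_add, zpow_one, Equiv.Perm.mul_apply, hk]
  rw [← Equiv.Perm.smul_def, Finset.smul_mem_smul_finset_iff, Finset.mem_compl,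
    Equiv.Perm.smul_def, hs hk, hs hgk, Int.even_add]
  simp

/-- For `n ≡ 0 (mod 6)`, a permutation of `Fin n` that is a product of three disjoint
`n/3`-cycles (with no fixed points) maps some subset of size `n/2` to its complement; in
particular it lies in the stabilizer of a partition of `Fin n` into two blocks of size
`n/2`. -/
theorem three_cycles_preserve_partition (n : ℕ) (hmod : n % 6 = 0)
    (g : Equiv.Perm (Fin n)) (hg : g.cycleType = {n / 3, n / 3, n / 3}) :
    ∃ s : Finset (Fin n), s.card = n / 2 ∧ g • s = sᶜ := by
  have heven : ∀ m ∈ g.cycleType, Even m := by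
    intro m hm
    have : m = n / 3 := by simpa [hg] using hm
    rw [this, Nat.even_iff]
    omega
  have hsupport : g.support = Finset.univ := by
    rw [← Finset.card_eq_iff_eq_univ, ← Equiv.Perm.sum_cycleType, hg]
    simp
    omega
  obtain ⟨s, hs⟩ := Equiv.Perm.exists_smul_eq_compl heven fun x =>
    Equiv.Perm.mem_support.1 (hsupport ▸ Finset.mem_univ x)
  refine ⟨s, ?_, hs⟩
  have hcard := congrArg Finset.card hs
  rw [Finset.card_smul_finset, Finset.card_compl, Fintype.card_fin] at hcard
  have := s.card_le_univ
  rw [Fintype.card_fin] at this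
  omega
end

section
/- Let n be an even natural number with n ≥ 4 and fix a subset s of Fin n with |s| = n/2. Then the number of n-cycles g ∈ S_n satisfying g(s) = sᶜ equals (n/2)! · (n/2 − 1)!. Equivalently, the stabilizer of the partition {s, sᶜ} (the subgroup {g ∈ S_n : g(s) = s or g(s) = sᶜ}, isomorphic to S_{n/2} ≀ S_2) contains exactly (n/2)! · (n/2 − 1)! n-cycles. -/
open Pointwise

namespace Equiv.Perm

variable {α : Type*} [Fintype α] [DecidableEq α]

theorem smul_finset_eq_compl_iff {g : Perm α} {s : Finset α} :
    g • s = sᶜ ↔ ∀ x, g x ∈ s ↔ x ∉ s := by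
  rw [eq_comm, Finset.ext_iff, ← g.forall_congr_right]
  refine forall_congr' fun x => ?_
  rw [← Perm.smul_def, Finset.smul_mem_smul_finset_iff, Finset.mem_compl]
  tauto

theorem pow_apply_mem_iff_of_smul_finset_eq_compl {g : Perm α} {s : Finset α}
    (h : g • s = sᶜ) (x : α) (k : ℕ) : (g ^ k) x ∈ s ↔ (x ∈ s ↔ Even k) := by
  induction k with
  | zero => simp
  | succ k ih =>
    rw [pow_succ', mul_apply, smul_finset_eq_compl_iff.1 h, ih, Nat.even_add_one]
    tauto

theorem eq_of_smul_finset_eq_compl {g : Perm α} {x : α} (hg : ∀ y, ∃ k : ℕ, (g ^ k) x = y)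
    {s t : Finset α} (hs : g • s = sᶜ) (ht : g • t = tᶜ) (hx : x ∈ s ↔ x ∈ t) : s = t := by
  ext y
  obtain ⟨k, rfl⟩ := hg y
  rw [pow_apply_mem_iff_of_smul_finset_eq_compl hs, pow_apply_mem_iff_of_smul_finset_eq_compl ht,
    hx]

theorem compl_smul_finset_eq_compl {g : Perm α} {s : Finset α} (h : g • s = sᶜ) :
    g • sᶜ = sᶜᶜ := by
  rw [smul_finset_eq_compl_iff] at h ⊢
  intro x
  rw [Finset.mem_compl, Finset.mem_compl, h x]

theorem IsCycle.exists_smul_finset_eq_compl {g : Perm α} (hg : g.IsCycle)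
    (he : Even g.support.card) {x : α} (hx : ∀ y, ∃ k : ℕ, (g ^ k) x = y) (hgx : g x ≠ x) :
    ∃ s : Finset α, x ∈ s ∧ g • s = sᶜ := by
  classical
  have key (k : ℕ) : (∃ j : ℕ, Even j ∧ (g ^ j) x = (g ^ k) x) ↔ Even k := by
    refine ⟨?_, fun h => ⟨k, h, rfl⟩⟩
    rintro ⟨j, hj, h⟩
    have h₁ := pow_eq_pow_iff_modEq.1 (hg.pow_eq_pow_iff.2 ⟨x, hgx, h⟩)
    rw [hg.orderOf] at h₁
    have h₂ : j % 2 = k % 2 := h₁.of_dvd he.two_dvd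
    rw [Nat.even_iff] at hj ⊢
    omega
  refine ⟨Finset.univ.filter fun y => ∃ j : ℕ, Even j ∧ (g ^ j) x = y, ?_,
    smul_finset_eq_compl_iff.2 fun y => ?_⟩
  · simpa using (key 0).2 Even.zero
  · obtain ⟨k, rfl⟩ := hx y
    rw [Finset.mem_filter_univ, Finset.mem_filter_univ, key, ← mul_apply, ← pow_succ', key,
      Nat.even_add_one]

/-- A cycle of even length moving every point swaps exactly two sets with their complements. -/
theorem IsCycle.card_filter_smul_finset_eq_compl {g : Perm α} (hg : g.IsCycle)
    (hsupp : g.support = Finset.univ) (he : Even (Fintype.card α)) :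
    (Finset.univ.filter fun s : Finset α => g • s = sᶜ).card = 2 := by
  have hmove (y : α) : g y ≠ y := by
    rw [← mem_support, hsupp]
    exact Finset.mem_univ y
  obtain ⟨x, hgx, -⟩ := id hg
  have hx (y : α) : ∃ k : ℕ, (g ^ k) x = y := hg.exists_pow_eq hgx (hmove y)
  obtain ⟨s, hxs, hs⟩ := hg.exists_smul_finset_eq_compl
    (by rwa [hsupp, Finset.card_univ]) hx hgx
  have hne : s ≠ sᶜ := fun h => Finset.mem_compl.1 (h ▸ hxs) hxs
  rw [← Finset.card_pair hne]
  congr 1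
  ext t
  simp only [Finset.mem_filter_univ, Finset.mem_insert, Finset.mem_singleton]
  constructor
  · intro ht
    by_cases hxt : x ∈ t
    · exact .inl (eq_of_smul_finset_eq_compl hx ht hs (by tauto))
    · refine .inr (eq_of_smul_finset_eq_compl hx ht (compl_smul_finset_eq_compl hs) ?_)
      rw [Finset.mem_compl]
      tauto
  · rintro (rfl | rfl)
    · exact hs
    · exact compl_smul_finset_eq_compl hs

theorem two_mul_card_of_smul_finset_eq_compl {g : Perm α} {s : Finset α} (h : g • s = sᶜ) :
    2 * s.card = Fintype.card α := by
  have h₁ := congrArg Finset.card h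
  rw [Finset.card_smul_finset] at h₁
  have h₂ := s.card_add_card_compl
  omega

theorem exists_mem_iff_mem_of_card_eq {s t : Finset α} (h : s.card = t.card) :
    ∃ σ : Perm α, ∀ x, σ x ∈ t ↔ x ∈ s := by
  let e : {x // x ∈ s} ≃ {x // x ∈ t} := Finset.equivOfCardEq h
  exact ⟨e.extendSubtype, fun x => ⟨fun hx => by
    by_contra hxs
    exact e.extendSubtype_not_mem x hxs hx, e.extendSubtype_mem x⟩⟩

theorem card_filter_cycleType_and_smul_finset_eq_compl_le (m : Multiset ℕ) {s t : Finset α}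
    (h : s.card = t.card) :
    (Finset.univ.filter fun g : Perm α => g.cycleType = m ∧ g • s = sᶜ).card ≤
      (Finset.univ.filter fun g : Perm α => g.cycleType = m ∧ g • t = tᶜ).card := by
  obtain ⟨σ, hσ⟩ := exists_mem_iff_mem_of_card_eq h
  refine Finset.card_le_card_of_injOn (fun g => σ * g * σ⁻¹) ?_
    fun a _ b _ hab => by simpa using hab
  intro g hg
  simp only [Finset.coe_filter, Finset.mem_univ, true_and, Set.mem_ofPred_eq,
    smul_finset_eq_compl_iff] at hg ⊢
  refine ⟨by rw [cycleType_conj, hg.1], fun x => ?_⟩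
  obtain ⟨y, rfl⟩ := σ.surjective x
  simp [hσ, hg.2]

theorem card_filter_cycleType_and_smul_finset_eq_compl_congr (m : Multiset ℕ) {s t : Finset α}
    (h : s.card = t.card) :
    (Finset.univ.filter fun g : Perm α => g.cycleType = m ∧ g • s = sᶜ).card =
      (Finset.univ.filter fun g : Perm α => g.cycleType = m ∧ g • t = tᶜ).card :=
  (card_filter_cycleType_and_smul_finset_eq_compl_le m h).antisymm
    (card_filter_cycleType_and_smul_finset_eq_compl_le m h.symm)

theorem choose_mul_card_filter_cycleType_and_smul_finset_eq_compl {m : ℕ} (hm : m ≠ 0)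
    (hα : Fintype.card α = 2 * m) {s : Finset α} (hs : s.card = m) :
    (2 * m).choose m *
        (Finset.univ.filter fun g : Perm α => g.cycleType = {2 * m} ∧ g • s = sᶜ).card =
      (2 * m - 1).factorial * 2 := by
  have hcycles := card_of_cycleType_singleton (α := α) (n := 2 * m) (by omega) hα.ge
  rw [hα, Nat.choose_self, mul_one] at hcycles
  rw [← hcycles, ← hα, ← Finset.card_univ, ← Finset.card_powersetCard]
  symm
  refine Finset.card_mul_eq_card_mul (fun (g : Perm α) (t : Finset α) => g • t = tᶜ) ?_ ?_
  · intro g hg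
    rw [Finset.mem_filter_univ, Finset.card_univ, hα] at hg
    have hcyc : g.IsCycle := by rw [← card_cycleType_eq_one, hg, Multiset.card_singleton]
    have hsupp : g.support = Finset.univ := by
      rw [← Finset.card_eq_iff_eq_univ, ← sum_cycleType, hg, Multiset.sum_singleton, hα]
    rw [← hcyc.card_filter_smul_finset_eq_compl hsupp (hα ▸ even_two_mul m)]
    congr 1
    ext t
    simp only [Finset.mem_bipartiteAbove, Finset.mem_powersetCard_univ, Finset.mem_filter_univ,
      and_iff_right_iff_imp]
    intro ht
    have := two_mul_card_of_smul_finset_eq_compl ht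
    omega
  · intro t ht
    rw [Finset.mem_powersetCard_univ] at ht
    rw [Finset.bipartiteBelow, Finset.filter_filter]
    exact card_filter_cycleType_and_smul_finset_eq_compl_congr _ (ht.trans hs.symm)

end Equiv.Perm

/-- For even `n ≥ 4` and a subset `s` of `Fin n` with `|s| = n/2`, the number of
`n`-cycles `g ∈ S_n` with `g(s) = sᶜ` is `(n/2)! · (n/2 − 1)!`; equivalently, the
stabilizer of the partition `{s, sᶜ}` (isomorphic to `S_{n/2} ≀ S_2`) contains exactly
`(n/2)! · (n/2 − 1)!` `n`-cycles. -/
theorem card_nCycles_mapping_to_compl (n : ℕ) (hmod : n % 2 = 0) (hn : 4 ≤ n)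
    (s : Finset (Fin n)) (hs : s.card = n / 2) :
    {g : Equiv.Perm (Fin n) | g.cycleType = {n} ∧ g • s = sᶜ}.ncard =
      (n / 2).factorial * (n / 2 - 1).factorial := by
  obtain ⟨m, rfl⟩ : ∃ m, n = 2 * m := ⟨n / 2, by omega⟩
  have hm : 2 * m / 2 = m := by omega
  rw [hm] at hs ⊢
  obtain ⟨k, rfl⟩ : ∃ k, m = k + 1 := ⟨m - 1, by omega⟩
  have key := Equiv.Perm.choose_mul_card_filter_cycleType_and_smul_finset_eq_compl
    (Nat.succ_ne_zero k) (Fintype.card_fin _) hs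
  have hchoose := Nat.choose_mul_factorial_mul_factorial
    (show k + 1 ≤ 2 * (k + 1) by omega)
  have hfact := Nat.mul_factorial_pred (show 2 * (k + 1) ≠ 0 by omega)
  rw [show 2 * (k + 1) - (k + 1) = k + 1 by omega] at hchoose
  rw [Set.ncard_eq_toFinset_card', Set.toFinset_ofPred]
  refine Nat.eq_of_mul_eq_mul_left
    (Nat.mul_pos (Nat.choose_pos (show k + 1 ≤ 2 * (k + 1) by omega)) k.succ_pos) ?_
  rw [mul_right_comm, key]
  have hk : (k + 1).factorial = (k + 1) * k.factorial := Nat.factorial_succ k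
  rw [Nat.add_sub_cancel]
  calc (2 * (k + 1) - 1).factorial * 2 * (k + 1)
      = (2 * (k + 1)).choose (k + 1) * (k + 1).factorial * (k + 1).factorial := by
        rw [hchoose, ← hfact]; ring
    _ = (2 * (k + 1)).choose (k + 1) * (k + 1) * ((k + 1).factorial * k.factorial) := by
        rw [hk]; ring
end
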